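/- Let a ∈ I₁ and consider the map ·a : I₁ → I₁, b ↦ ba, which is a homomorphism of left I₁-modules. Then: (1) the kernel ker(·a) = {b ∈ I₁ : ba = 0} has finite length as a left I₁-module if and only if the cokernel I₁/I₁a has finite length as a left I₁-module, and both hold if and only if a ∉ F; (2) the image I₁a has finite length as a left I₁-module if and only if a ∈ F. -/

import Mathlib

open Polynomial

noncomputable section
set_option synthInstance.maxHeartbeats 1000000
set_option maxHeartbeats 1000000
set_option linter.unusedSectionVars false

variable (K : Type*) [Field K] [CharZero K]

/-- The derivative operator `∂ = d/dx` on `K[x]`. -/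
def derOp : Module.End K (Polynomial K) := Polynomial.derivative

/-- The multiplication-by-`x` operator on `K[x]`. -/
def xOp : Module.End K (Polynomial K) := LinearMap.mulLeft K Polynomial.X

/-- The integration operator `∫`, determined by `∫ xⁿ = xⁿ⁺¹/(n+1)`. -/
def intOp : Module.End K (Polynomial K) :=
  (Polynomial.basisMonomials K).constr K fun n => ((n : K) + 1)⁻¹ • X ^ (n + 1)

/-- The algebra `I₁` of polynomial integro-differential operators: the subalgebra of
`End_K(K[x])` generated by `x`, `∂` and `∫`. -/
def I1 : Subalgebra K (Module.End K (Polynomial K)) :=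
  Algebra.adjoin K {xOp K, derOp K, intOp K}

/-- `e_{ij} := ∫^i ∂^j − ∫^{i+1} ∂^{j+1}`. -/
def eOp (i j : ℕ) : Module.End K (Polynomial K) :=
  intOp K ^ i * derOp K ^ j - intOp K ^ (i + 1) * derOp K ^ (j + 1)

/-- `F`, the `K`-linear span of the `e_{ij}`; it is the (two-sided) ideal of compact
operators of `I₁`. -/
def Fset : Submodule K (Module.End K (Polynomial K)) :=
  Submodule.span K {f | ∃ i j, f = eOp K i j}

lemma xOp_mem : xOp K ∈ I1 K := Algebra.subset_adjoin (by simp)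
lemma derOp_mem : derOp K ∈ I1 K := Algebra.subset_adjoin (by simp)
lemma intOp_mem : intOp K ∈ I1 K := Algebra.subset_adjoin (by simp)

lemma eOp_mem (i j : ℕ) : eOp K i j ∈ I1 K :=
  sub_mem (mul_mem (pow_mem (intOp_mem K) i) (pow_mem (derOp_mem K) j))
    (mul_mem (pow_mem (intOp_mem K) (i + 1)) (pow_mem (derOp_mem K) (j + 1)))

/-- `e_{ij}` as an element of the ring `I₁`. -/
def eI (i j : ℕ) : I1 K := ⟨eOp K i j, eOp_mem K i j⟩

/-- `∂` as an element of the ring `I₁`. -/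
def derI : I1 K := ⟨derOp K, derOp_mem K⟩

/-- `∫` as an element of the ring `I₁`. -/
def intI : I1 K := ⟨intOp K, intOp_mem K⟩

/-- `H := ∂ ∘ x` (first multiply by `x`, then differentiate). -/
def hOp : Module.End K (Polynomial K) := derOp K * xOp K

/-- `K[H]`, the unital subalgebra of `I₁` generated by `H`. -/
def KH : Subalgebra K (Module.End K (Polynomial K)) := Algebra.adjoin K {hOp K}

/-- The action of `a ∈ I₁` on a left `I₁`-module `M`, as a `K`-linear map `a_M : M → M`. -/
def actMap (a : I1 K) (M : Type*) [AddCommGroup M] [Module (I1 K) M] [Module K M]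
    [SMulCommClass K (I1 K) M] : M →ₗ[K] M where
  toFun m := a • m
  map_add' := smul_add a
  map_smul' k m := (smul_comm k a m).symm

/-- Right multiplication `b ↦ b * a` in a ring `R`, as a homomorphism of left `R`-modules. -/
def rmulMap (R : Type*) [Ring R] (a : R) : R →ₗ[R] R where
  toFun b := b * a
  map_add' b c := add_mul b c a
  map_smul' c b := by simp [smul_eq_mul, mul_assoc]

/-- Left multiplication `b ↦ a * b` in a ring `R`, as a homomorphism of right `R`-modules
(i.e. of left `Rᵐᵒᵖ`-modules). -/
def lmulMap (R : Type*) [Ring R] (a : R) : R →ₗ[Rᵐᵒᵖ] R where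
  toFun b := a * b
  map_add' b c := mul_add a b c
  map_smul' c b := by simp [MulOpposite.smul_eq_mul_unop, mul_assoc]

/-- The centralizer `Cen_{I₁}(a) = {b ∈ I₁ : ab = ba}` of `a` in `I₁`, as a subalgebra of
`End_K(K[x])`. -/
def Cen (a : Module.End K (Polynomial K)) : Subalgebra K (Module.End K (Polynomial K)) :=
  I1 K ⊓ Subalgebra.centralizer K {a}

/-- `Cen_F(a) = {f ∈ F : af = fa}`, a `K`-subspace of `End_K(K[x])`. -/
def CenF (a : Module.End K (Polynomial K)) : Submodule K (Module.End K (Polynomial K)) :=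
  Fset K ⊓ Subalgebra.toSubmodule (Subalgebra.centralizer K {a})


/-- The cokernel `R ⧸ Im f` of a homomorphism of left `R`-modules `f : R → R`. -/
abbrev Coker (R : Type*) [Ring R] (f : R →ₗ[R] R) : Type _ := R ⧸ LinearMap.range f

/-- The cokernel `R ⧸ Im f` of a homomorphism of right `R`-modules `f : R → R`. -/
abbrev CokerOp (R : Type*) [Ring R] (f : R →ₗ[Rᵐᵒᵖ] R) : Type _ := R ⧸ LinearMap.range f

section Growth

open Module

variable {K}

/-- Rank–nullity for the restriction of a linear map to a finite-dimensional subspace. -/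
lemma finrank_map_add_finrank_inf_ker {V W : Type*} [AddCommGroup V] [Module K V]
    [AddCommGroup W] [Module K W] (f : V →ₗ[K] W) (S : Submodule K V) [FiniteDimensional K S] :
    finrank K (S.map f) + finrank K (S ⊓ LinearMap.ker f : Submodule K V) = finrank K S := by
  have h := LinearMap.finrank_range_add_finrank_ker (f.domRestrict S)
  rw [LinearMap.range_domRestrict, LinearMap.ker_domRestrict] at h
  rw [← h, ← Submodule.finrank_map_subtype_eq S (Submodule.comap S.subtype (LinearMap.ker f)),
    Submodule.map_comap_subtype]

lemma finiteDimensional_comap {V W : Type*} [AddCommGroup V] [Module K V]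
    [AddCommGroup W] [Module K W] {f : V →ₗ[K] W} (hf : Function.Injective f)
    (S : Submodule K W) [FiniteDimensional K S] : FiniteDimensional K (S.comap f) := by
  let g : S.comap f →ₗ[K] S := f.restrict fun _ h => h
  have hg : Function.Injective g := fun v w hvw => by
    have h : f v = f w := congrArg (fun s : S => (s : W)) hvw
    exact Subtype.ext (hf h)
  exact FiniteDimensional.of_injective g hg

/-- In characteristic zero the relation `DX - XD = 1` has no nonzero finite-dimensional
representation. -/
lemma eq_bot_of_commutator_eq_one {V : Type*} [AddCommGroup V] [Module K V]
    {D X : End K V} (h : D * X - X * D = 1) (S : Submodule K V) [FiniteDimensional K S]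
    (hD : ∀ v ∈ S, D v ∈ S) (hX : ∀ v ∈ S, X v ∈ S) : S = ⊥ := by
  have key : (D.restrict hD) * (X.restrict hX) - (X.restrict hX) * (D.restrict hD) = 1 := by
    ext v
    simpa using LinearMap.congr_fun h (v : V)
  have ht := congrArg (LinearMap.trace K S) key
  rw [map_sub, LinearMap.trace_mul_comm, sub_self, LinearMap.trace_one] at ht
  exact Submodule.finrank_eq_zero.mp (by exact_mod_cast ht.symm)

/-- A filtration of a representation of `DX - XD = 1` grows by at least one at each step
once it is nonzero. -/
lemma lt_finrank_filtration {V : Type*} [AddCommGroup V] [Module K V]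
    {D X : End K V} (h : D * X - X * D = 1) (Γ : ℕ → Submodule K V)
    [∀ n, FiniteDimensional K (Γ n)] (hmono : Monotone Γ)
    (hD : ∀ n, ∀ v ∈ Γ n, D v ∈ Γ (n + 1)) (hX : ∀ n, ∀ v ∈ Γ n, X v ∈ Γ (n + 1))
    {n : ℕ} (hn : Γ n ≠ ⊥) (t : ℕ) : t < finrank K (Γ (n + t)) := by
  induction t with
  | zero => exact Nat.pos_of_ne_zero fun h0 => hn (Submodule.finrank_eq_zero.mp h0)
  | succ t ih =>
    have hle : Γ (n + t) ≤ Γ (n + t + 1) := hmono (Nat.le_succ _)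
    refine lt_of_le_of_lt (Nat.succ_le_of_lt ih) (Submodule.finrank_lt_finrank_of_lt
      (lt_of_le_of_ne hle fun heq => hn ?_))
    have hbot : Γ (n + t) = ⊥ := eq_bot_of_commutator_eq_one h _
      (fun v hv => heq ▸ hD _ v hv) (fun v hv => heq ▸ hX _ v hv)
    exact le_bot_iff.mp (hbot ▸ hmono (Nat.le_add_right n t))

/-- A module over an algebra containing a copy of the Weyl algebra has finite length as soon as
it has an exhaustive filtration of at most linear growth. -/
theorem isFiniteLength_of_linear_growth {A M : Type*} [Ring A] [Algebra K A] [AddCommGroup M]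
    [Module A M] [Module K M] [IsScalarTower K A M] {D X : A} (h : D * X - X * D = 1)
    (Γ : ℕ → Submodule K M) [∀ n, FiniteDimensional K (Γ n)] (hmono : Monotone Γ)
    (hD : ∀ n, ∀ v ∈ Γ n, D • v ∈ Γ (n + 1)) (hX : ∀ n, ∀ v ∈ Γ n, X • v ∈ Γ (n + 1))
    (hex : ∀ v, ∃ n, v ∈ Γ n) (C : ℕ) (hC : ∀ n, finrank K (Γ n) ≤ C * (n + 1)) :
    IsFiniteLength A M := by
  have step (L L' : Submodule A M) (hL : L < L') : ∃ n₀, ∀ t,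
      finrank K (Γ (n₀ + t) ⊓ L.restrictScalars K : Submodule K M) + t
        ≤ finrank K (Γ (n₀ + t) ⊓ L'.restrictScalars K : Submodule K M) := by
    obtain ⟨u, huL', huL⟩ := SetLike.exists_of_lt hL
    obtain ⟨n₀, hn₀⟩ := hex u
    refine ⟨n₀, fun t => ?_⟩
    let π : M →ₗ[K] M ⧸ L := L.mkQ.restrictScalars K
    have hker : LinearMap.ker π = L.restrictScalars K := by
      ext v; simp [π]
    have hcomm : Algebra.lsmul K K (M ⧸ L) D * Algebra.lsmul K K (M ⧸ L) X
        - Algebra.lsmul K K (M ⧸ L) X * Algebra.lsmul K K (M ⧸ L) D = 1 := by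
      rw [← map_mul, ← map_mul, ← map_sub, h, map_one]
    have hgrow := lt_finrank_filtration hcomm
      (fun n => (Γ n ⊓ L'.restrictScalars K).map π)
      (fun i j hij => Submodule.map_mono (inf_le_inf_right _ (hmono hij)))
      (by
        rintro n _ ⟨v, ⟨hv, hv'⟩, rfl⟩
        exact ⟨D • v, ⟨hD n v hv, L'.smul_mem D hv'⟩, rfl⟩)
      (by
        rintro n _ ⟨v, ⟨hv, hv'⟩, rfl⟩
        exact ⟨X • v, ⟨hX n v hv, L'.smul_mem X hv'⟩, rfl⟩)
      (n := n₀) (by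
        intro hbot
        have hmem : π u ∈ (Γ n₀ ⊓ L'.restrictScalars K).map π := ⟨u, ⟨hn₀, huL'⟩, rfl⟩
        rw [hbot, Submodule.mem_bot] at hmem
        have : u ∈ LinearMap.ker π := hmem
        rw [hker] at this
        exact huL this) t
    have hrank := finrank_map_add_finrank_inf_ker π (Γ (n₀ + t) ⊓ L'.restrictScalars K)
    have hinf : Γ (n₀ + t) ⊓ L'.restrictScalars K ⊓ LinearMap.ker π
        = Γ (n₀ + t) ⊓ L.restrictScalars K := by
      rw [hker, inf_assoc, inf_eq_right.mpr (show L.restrictScalars K ≤ L'.restrictScalars K from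
        hL.le)]
    rw [hinf] at hrank
    omega
  have chain (p : LTSeries (Submodule A M)) (i : ℕ) (hi : i < p.length + 1) :
      ∃ c, ∀ n, i * n ≤ finrank K (Γ n ⊓ (p ⟨i, hi⟩).restrictScalars K : Submodule K M) + c := by
    induction i with
    | zero => exact ⟨0, fun n => by simp⟩
    | succ i ih =>
      obtain ⟨c, hc⟩ := ih (by omega)
      obtain ⟨n₀, hn₀⟩ := step (p ⟨i, by omega⟩) (p ⟨i + 1, hi⟩)
        (p.strictMono (by simp [Fin.lt_def]))
      refine ⟨c + (i + 1) * n₀, fun n => ?_⟩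
      rcases le_total n₀ n with hle | hle
      · obtain ⟨t, rfl⟩ := Nat.exists_eq_add_of_le hle
        have h1 := hc (n₀ + t)
        have h2 := hn₀ t
        nlinarith
      · nlinarith [Nat.mul_le_mul_left (i + 1) hle]
  rw [← Module.length_ne_top_iff]
  have hbound : Order.krullDim (Submodule A M) ≤ ((C : ℕ∞) : WithBot ℕ∞) := by
    refine iSup_le fun p => ?_
    obtain ⟨c, hc⟩ := chain p p.length (Nat.lt_succ_self _)
    have hle : p.length ≤ C := by
      by_contra hlt
      have h1 := hc (C + c + 1)
      have h2 := hC (C + c + 1)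
      have h3 := Submodule.finrank_mono
        (inf_le_left : Γ (C + c + 1) ⊓ (p ⟨p.length, Nat.lt_succ_self _⟩).restrictScalars K ≤ _)
      have h4 := Nat.mul_le_mul_right (C + c + 1) (Nat.succ_le_of_lt (not_le.mp hlt))
      simp only [Nat.succ_eq_add_one] at h4
      nlinarith
    exact_mod_cast hle
  rw [← Module.coe_length] at hbound
  exact ne_top_of_le_ne_top (ENat.natCast_ne_top C) (WithBot.coe_le_coe.mp hbound)

end Growth

section Entries

/-- The `(i, j)` matrix entry of an operator on `K[x]` in the basis `xⁿ / n!`. -/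
def entry (i j : ℕ) : Module.End K K[X] →ₗ[K] K :=
  ((i.factorial : K) * (j.factorial : K)⁻¹) •
    (Polynomial.lcoeff K i ∘ₗ LinearMap.applyₗ (X ^ j : K[X]))

lemma entry_apply (i j : ℕ) (T : Module.End K K[X]) :
    entry K i j T = (i.factorial : K) * (j.factorial : K)⁻¹ * (T (X ^ j)).coeff i := rfl

lemma entry_eq_zero_iff {i j : ℕ} {T : Module.End K K[X]} :
    entry K i j T = 0 ↔ (T (X ^ j)).coeff i = 0 := by
  have hi : (i.factorial : K) ≠ 0 := by exact_mod_cast i.factorial_ne_zero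
  have hj : (j.factorial : K) ≠ 0 := by exact_mod_cast j.factorial_ne_zero
  simp [entry_apply, hi, hj]

lemma intOp_monomial (n : ℕ) (c : K) :
    intOp K (monomial n c) = monomial (n + 1) (c * ((n : K) + 1)⁻¹) := by
  have h : intOp K (monomial n 1) = ((n : K) + 1)⁻¹ • X ^ (n + 1) := by
    have h := (Polynomial.basisMonomials K).constr_basis K
      (fun n => (((n : K) + 1)⁻¹ • X ^ (n + 1) : K[X])) n
    rw [Polynomial.coe_basisMonomials] at h
    exact h
  rw [← mul_one c, ← smul_eq_mul, ← smul_monomial, map_smul, h, ← monomial_one_right_eq_X_pow]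
  simp [smul_monomial]

lemma coeff_intOp_zero (p : K[X]) : (intOp K p).coeff 0 = 0 := by
  induction p using Polynomial.induction_on' with
  | add p q hp hq => simp [hp, hq]
  | monomial n c => simp [intOp_monomial, coeff_monomial]

lemma coeff_intOp_succ (p : K[X]) (i : ℕ) :
    (intOp K p).coeff (i + 1) = p.coeff i * ((i : K) + 1)⁻¹ := by
  induction p using Polynomial.induction_on' with
  | add p q hp hq => simp [hp, hq, add_mul]
  | monomial n c =>
    rw [intOp_monomial, coeff_monomial, coeff_monomial]
    by_cases h : n = i
    · simp [h]
    · simp [h]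

lemma entry_xOp_mul_zero (j : ℕ) (T : Module.End K K[X]) : entry K 0 j (xOp K * T) = 0 := by
  simp [entry_eq_zero_iff, xOp]

lemma entry_xOp_mul_succ (i j : ℕ) (T : Module.End K K[X]) :
    entry K (i + 1) j (xOp K * T) = ((i : K) + 1) * entry K i j T := by
  simp only [entry_apply, Module.End.mul_apply, xOp, LinearMap.mulLeft_apply, coeff_X_mul,
    Nat.factorial_succ]
  push_cast
  ring

lemma entry_derOp_mul (i j : ℕ) (T : Module.End K K[X]) :
    entry K i j (derOp K * T) = entry K (i + 1) j T := by
  simp only [entry_apply, Module.End.mul_apply, derOp, coeff_derivative, Nat.factorial_succ]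
  push_cast
  ring

lemma entry_intOp_mul_zero (j : ℕ) (T : Module.End K K[X]) : entry K 0 j (intOp K * T) = 0 := by
  simp [entry_eq_zero_iff, coeff_intOp_zero]

lemma entry_intOp_mul_succ (i j : ℕ) (T : Module.End K K[X]) :
    entry K (i + 1) j (intOp K * T) = entry K i j T := by
  have hi : (i : K) + 1 ≠ 0 := by exact_mod_cast i.succ_ne_zero
  simp only [entry_apply, Module.End.mul_apply, coeff_intOp_succ, Nat.factorial_succ]
  push_cast
  field_simp

/-- Operators on `K[x]` that shift degrees by at most `n` and whose matrix entries along each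
diagonal are, from column `n` on, given by a polynomial of degree at most `n`. -/
def bandOp (n : ℕ) : Submodule K (Module.End K K[X]) where
  carrier := {T | (∀ i j, j + n < i → entry K i j T = 0) ∧
    (∀ i j, i + n < j → entry K i j T = 0) ∧
    ∀ d : ℤ, ∃ p : K[X], p.natDegree ≤ n ∧
      ∀ i j : ℕ, n ≤ j → (i : ℤ) = j + d → entry K i j T = p.eval (j : K)}
  zero_mem' := ⟨by simp, by simp, fun _ => ⟨0, by simp, by simp⟩⟩
  add_mem' := by
    rintro S T ⟨hS, hS', hS''⟩ ⟨hT, hT', hT''⟩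
    refine ⟨fun i j h => by simp [hS i j h, hT i j h], fun i j h => by simp [hS' i j h, hT' i j h],
      fun d => ?_⟩
    obtain ⟨p, hp, hp'⟩ := hS'' d
    obtain ⟨q, hq, hq'⟩ := hT'' d
    exact ⟨p + q, natDegree_add_le_of_degree_le hp hq,
      fun i j hj hd => by simp [hp' i j hj hd, hq' i j hj hd]⟩
  smul_mem' := by
    rintro c T ⟨hT, hT', hT''⟩
    refine ⟨fun i j h => by simp [hT i j h], fun i j h => by simp [hT' i j h], fun d => ?_⟩
    obtain ⟨p, hp, hp'⟩ := hT'' d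
    exact ⟨c • p, (natDegree_smul_le c p).trans hp, fun i j hj hd => by simp [hp' i j hj hd]⟩

variable {K}

lemma one_mem_bandOp : (1 : Module.End K K[X]) ∈ bandOp K 0 := by
  have h (i j : ℕ) (hij : i ≠ j) : entry K i j (1 : Module.End K K[X]) = 0 := by
    simp [entry_eq_zero_iff, coeff_X_pow, hij]
  refine ⟨fun i j hij => h i j (by omega), fun i j hij => h i j (by omega), fun d => ?_⟩
  by_cases hd : d = 0
  · refine ⟨1, by simp, fun i j _ hij => ?_⟩
    obtain rfl : i = j := by omega
    have hi : (i.factorial : K) ≠ 0 := by exact_mod_cast i.factorial_ne_zero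
    simp [entry_apply, hi]
  · exact ⟨0, by simp, fun i j _ hij => by rw [h i j (by omega), eval_zero]⟩

lemma bandOp_le_succ (n : ℕ) : bandOp K n ≤ bandOp K (n + 1) := by
  rintro T ⟨h1, h2, h3⟩
  refine ⟨fun i j h => h1 i j (by omega), fun i j h => h2 i j (by omega), fun d => ?_⟩
  obtain ⟨p, hp, hp'⟩ := h3 d
  exact ⟨p, by omega, fun i j hj hd => hp' i j (by omega) hd⟩

lemma xOp_mul_mem_bandOp {n : ℕ} {T : Module.End K K[X]} (hT : T ∈ bandOp K n) :
    xOp K * T ∈ bandOp K (n + 1) := by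
  obtain ⟨h1, h2, h3⟩ := hT
  refine ⟨fun i j h => ?_, fun i j h => ?_, fun d => ?_⟩
  · cases i with
    | zero => exact entry_xOp_mul_zero K j T
    | succ i => rw [entry_xOp_mul_succ, h1 i j (by omega), mul_zero]
  · cases i with
    | zero => exact entry_xOp_mul_zero K j T
    | succ i => rw [entry_xOp_mul_succ, h2 i j (by omega), mul_zero]
  · obtain ⟨p, hp, hp'⟩ := h3 (d - 1)
    refine ⟨(X + C (d : K)) * p, ?_, fun i j hj hd => ?_⟩
    · have := natDegree_mul_le (p := X + C (d : K)) (q := p)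
      rw [natDegree_X_add_C] at this
      omega
    · have hd' : (j : K) + (d : K) = i := by exact_mod_cast congrArg (Int.cast (R := K)) hd.symm
      rw [eval_mul, eval_add, eval_X, eval_C, hd']
      cases i with
      | zero => rw [entry_xOp_mul_zero, Nat.cast_zero, zero_mul]
      | succ i =>
        rw [entry_xOp_mul_succ, hp' i j (by omega) (by push_cast at hd; omega)]
        push_cast
        ring

lemma derOp_mul_mem_bandOp {n : ℕ} {T : Module.End K K[X]} (hT : T ∈ bandOp K n) :
    derOp K * T ∈ bandOp K (n + 1) := by
  obtain ⟨h1, h2, h3⟩ := hT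
  refine ⟨fun i j h => ?_, fun i j h => ?_, fun d => ?_⟩
  · rw [entry_derOp_mul, h1 (i + 1) j (by omega)]
  · rw [entry_derOp_mul, h2 (i + 1) j (by omega)]
  · obtain ⟨p, hp, hp'⟩ := h3 (d + 1)
    refine ⟨p, by omega, fun i j hj hd => ?_⟩
    rw [entry_derOp_mul, hp' (i + 1) j (by omega) (by push_cast; omega)]

lemma intOp_mul_mem_bandOp {n : ℕ} {T : Module.End K K[X]} (hT : T ∈ bandOp K n) :
    intOp K * T ∈ bandOp K (n + 1) := by
  obtain ⟨h1, h2, h3⟩ := hT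
  refine ⟨fun i j h => ?_, fun i j h => ?_, fun d => ?_⟩
  · cases i with
    | zero => exact entry_intOp_mul_zero K j T
    | succ i => rw [entry_intOp_mul_succ, h1 i j (by omega)]
  · cases i with
    | zero => exact entry_intOp_mul_zero K j T
    | succ i => rw [entry_intOp_mul_succ, h2 i j (by omega)]
  · by_cases hdn : d ≤ -(n + 1 : ℤ)
    · refine ⟨0, by simp, fun i j hj hd => ?_⟩
      rw [eval_zero]
      cases i with
      | zero => exact entry_intOp_mul_zero K j T
      | succ i => rw [entry_intOp_mul_succ, h2 i j (by push_cast at hd; omega)]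
    · obtain ⟨p, hp, hp'⟩ := h3 (d - 1)
      refine ⟨p, by omega, fun i j hj hd => ?_⟩
      cases i with
      | zero => push_cast at hd; omega
      | succ i => rw [entry_intOp_mul_succ, hp' i j (by omega) (by push_cast at hd; omega)]

lemma natDegree_apply_X_pow_le {n : ℕ} {T : Module.End K K[X]} (hT : T ∈ bandOp K n) (j : ℕ) :
    (T (X ^ j)).natDegree ≤ j + n :=
  natDegree_le_iff_coeff_eq_zero.mpr fun i hi => (entry_eq_zero_iff K).mp (hT.1 i j hi)

lemma end_ext_X_pow {S T : Module.End K K[X]} (h : ∀ j : ℕ, S (X ^ j) = T (X ^ j)) : S = T := by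
  refine Polynomial.lhom_ext' fun j => LinearMap.ext_ring ?_
  simpa [monomial_one_right_eq_X_pow] using h j

/-- An operator in `bandOp K n` is determined by its first `2n + 1` columns. -/
lemma eq_zero_of_mem_bandOp {n : ℕ} {T : Module.End K K[X]} (hT : T ∈ bandOp K n)
    (h0 : ∀ j < 2 * n + 1, T (X ^ j) = 0) : T = 0 := by
  refine end_ext_X_pow fun j => ?_
  rcases lt_or_ge j (2 * n + 1) with hj | hj
  · simpa using h0 j hj
  ext i
  rw [LinearMap.zero_apply, coeff_zero, ← entry_eq_zero_iff]
  by_cases hij : i + n < j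
  · exact hT.2.1 i j hij
  obtain ⟨p, hp, hp'⟩ := hT.2.2 ((i : ℤ) - j)
  have hp0 : p = 0 := by
    refine eq_zero_of_natDegree_lt_card_of_eval_eq_zero p (ι := Fin (n + 1))
      (f := fun s => ((n + s : ℕ) : K)) (fun s t hst => ?_) (fun s => ?_) (by simpa using by omega)
    · have : n + (s : ℕ) = n + t := Nat.cast_injective (R := K) hst
      exact Fin.ext (by omega)
    · have hs := s.2
      rw [← hp' (n + s + i - j) (n + s) (by omega) (by omega), entry_eq_zero_iff,
        h0 _ (by omega), coeff_zero]
  rw [hp' i j (by omega) (by omega), hp0, eval_zero]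

end Entries

section CompactOperators

variable {K}

lemma intOp_derOp_apply (p : K[X]) : p - intOp K (derOp K p) = C (p.coeff 0) := by
  ext i
  cases i with
  | zero => simp [coeff_intOp_zero]
  | succ i =>
    have hi : (i : K) + 1 ≠ 0 := by exact_mod_cast i.succ_ne_zero
    simp [coeff_intOp_succ, derOp, coeff_derivative, hi]

lemma intOp_pow_C (i : ℕ) (c : K) :
    (intOp K ^ i) (C c) = monomial i (c * (i.factorial : K)⁻¹) := by
  induction i with
  | zero => simp
  | succ i ih =>
    rw [pow_succ', Module.End.mul_apply, ih, intOp_monomial, Nat.factorial_succ, Nat.cast_mul,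
      mul_inv, mul_assoc]
    push_cast
    ring_nf

lemma coeff_zero_derOp_pow (j : ℕ) (p : K[X]) :
    ((derOp K ^ j) p).coeff 0 = (j.factorial : K) * p.coeff j := by
  rw [Module.End.pow_apply]
  change (derivative^[j] p).coeff 0 = _
  rw [coeff_iterate_derivative, zero_add, Nat.descFactorial_self, nsmul_eq_mul]

lemma eOp_apply (i j : ℕ) (p : K[X]) :
    eOp K i j p = monomial i ((j.factorial : K) * p.coeff j * (i.factorial : K)⁻¹) := by
  have h : eOp K i j p = (intOp K ^ i) ((derOp K ^ j) p - intOp K (derOp K ((derOp K ^ j) p))) := by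
    rw [map_sub, eOp, pow_succ, pow_succ' (derOp K)]
    rfl
  rw [h, intOp_derOp_apply, coeff_zero_derOp_pow, intOp_pow_C]

/-- `F` consists of the operators that kill `xʲ` for all large `j`. -/
lemma mem_Fset_iff {T : Module.End K K[X]} :
    T ∈ Fset K ↔ ∃ N, ∀ j, N ≤ j → T (X ^ j) = 0 := by
  constructor
  · intro hT
    induction hT using Submodule.span_induction with
    | mem T hT =>
      obtain ⟨i, j, rfl⟩ := hT
      refine ⟨j + 1, fun k hk => ?_⟩
      rw [eOp_apply, coeff_X_pow, if_neg (by omega)]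
      simp
    | zero => exact ⟨0, by simp⟩
    | add S T _ _ hS hT =>
      obtain ⟨N, hN⟩ := hS
      obtain ⟨N', hN'⟩ := hT
      exact ⟨max N N', fun j hj => by
        simp [hN j (le_of_max_le_left hj), hN' j (le_of_max_le_right hj)]⟩
    | smul c T _ hT =>
      obtain ⟨N, hN⟩ := hT
      exact ⟨N, fun j hj => by simp [hN j hj]⟩
  · rintro ⟨N, hN⟩
    have hT : T = ∑ j ∈ Finset.range N, ∑ i ∈ Finset.range ((T (X ^ j)).natDegree + 1),
        entry K i j T • eOp K i j := by
      refine end_ext_X_pow fun k => ?_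
      have hterm (i j : ℕ) : (entry K i j T • eOp K i j) (X ^ k)
          = if k = j then monomial i ((T (X ^ j)).coeff i) else 0 := by
        have hi : (i.factorial : K) ≠ 0 := by exact_mod_cast i.factorial_ne_zero
        have hj : (j.factorial : K) ≠ 0 := by exact_mod_cast j.factorial_ne_zero
        rw [LinearMap.smul_apply, eOp_apply, coeff_X_pow, smul_monomial, entry_apply]
        by_cases hk : k = j
        · rw [if_pos hk, if_pos hk.symm, smul_eq_mul]
          congr 1
          field_simp
        · rw [if_neg hk, if_neg (Ne.symm hk)]
          simp
      simp only [LinearMap.sum_apply, hterm]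
      rw [Finset.sum_eq_single k]
      · simp only [if_true]
        by_cases hk : k < N
        · exact as_sum_range _
        · simp [hN k (not_lt.mp hk)]
      · intro j _ hj
        simp [Ne.symm hj]
      · intro hk
        simp [hN k (by simpa using hk)]
    rw [hT]
    exact Submodule.sum_mem _ fun j _ => Submodule.sum_mem _ fun i _ =>
      Submodule.smul_mem _ _ (Submodule.subset_span ⟨i, j, rfl⟩)

/-- If `a ∉ F` lies in some `bandOp K n`, then the right annihilator condition `b a = 0` makes `b`
determined by finitely many columns. -/
lemma exists_bound_of_notMem_Fset {n : ℕ} {a : Module.End K K[X]} (ha : a ∈ bandOp K n)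
    (haF : a ∉ Fset K) :
    ∃ N, ∀ b : Module.End K K[X], b * a = 0 → (∀ i < N, b (X ^ i) = 0) → b = 0 := by
  rw [mem_Fset_iff] at haF
  push Not at haF
  obtain ⟨j₀, hj₀, hne⟩ := haF n
  obtain ⟨h1, h2, h3⟩ := ha
  choose p hp hp' using h3
  have hex : ∃ i₀, entry K i₀ j₀ a ≠ 0 := by
    by_contra! hall
    exact hne (Polynomial.ext fun i => (entry_eq_zero_iff K).mp (hall i))
  obtain ⟨i₀, hi₀⟩ := hex
  have hnz : ∃ k : ℕ, p ((n : ℤ) - k) ≠ 0 := by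
    have hle : i₀ ≤ j₀ + n := by
      by_contra hlt
      exact hi₀ (h1 i₀ j₀ (by omega))
    refine ⟨j₀ + n - i₀, fun h0 => hi₀ ?_⟩
    rw [hp' ((n : ℤ) - (j₀ + n - i₀ : ℕ)) i₀ j₀ hj₀ (by omega), h0, eval_zero]
  classical
  let k := Nat.find hnz
  have hk : p ((n : ℤ) - k) ≠ 0 := Nat.find_spec hnz
  have hkmin : ∀ l < k, p ((n : ℤ) - l) = 0 := fun l hl => not_not.mp (Nat.find_min hnz hl)
  obtain ⟨R, hR⟩ : ∃ R : ℕ, ∀ j : ℕ, R ≤ j → (p ((n : ℤ) - k)).eval (j : K) ≠ 0 := by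
    have hfin : {j : ℕ | (p ((n : ℤ) - k)).eval (j : K) = 0}.Finite :=
      Set.Finite.preimage (Nat.cast_injective.injOn)
        (Polynomial.finite_setOfPred_isRoot hk)
    obtain ⟨R, hR⟩ := hfin.bddAbove
    exact ⟨R + 1, fun j hj h0 => by have := hR h0; omega⟩
  refine ⟨R + 2 * n + k, fun b hba hb => end_ext_X_pow fun i => ?_⟩
  rw [LinearMap.zero_apply]
  induction i using Nat.strong_induction_on with
  | _ i ih =>
    by_cases hi : i < R + 2 * n + k
    · exact hb i hi
    obtain ⟨j, hj⟩ : ∃ j, i + k = j + n := ⟨i + k - n, by omega⟩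
    have hlead : (a (X ^ j)).coeff i ≠ 0 := by
      rw [Ne, ← entry_eq_zero_iff, hp' ((n : ℤ) - k) i j (by omega) (by omega)]
      exact hR j (by omega)
    have hdeg : (a (X ^ j)).natDegree ≤ i := by
      refine natDegree_le_iff_coeff_eq_zero.mpr fun l hl => (entry_eq_zero_iff K).mp ?_
      by_cases hl' : j + n < l
      · exact h1 l j hl'
      · rw [hp' ((n : ℤ) - (j + n - l : ℕ)) l j (by omega) (by omega), hkmin _ (by omega),
          eval_zero]
    have hsum := LinearMap.congr_fun hba (X ^ j)
    rw [Module.End.mul_apply, LinearMap.zero_apply, as_sum_range' (a (X ^ j)) (i + 1) (by omega),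
      map_sum, Finset.sum_range_succ, Finset.sum_eq_zero, zero_add,
      ← mul_one ((a (X ^ j)).coeff i), ← smul_eq_mul, ← smul_monomial, map_smul,
      monomial_one_right_eq_X_pow] at hsum
    · exact (smul_eq_zero.mp hsum).resolve_left hlead
    · intro l hl
      rw [← mul_one ((a (X ^ j)).coeff l), ← smul_eq_mul, ← smul_monomial, map_smul,
        monomial_one_right_eq_X_pow, ih l (Finset.mem_range.mp hl), smul_zero]

end CompactOperators

section Filtration

open Module

/-- The span of all words of length at most `n` in `x`, `∂` and `∫`. -/
def wordFiltration (n : ℕ) : Submodule K (Module.End K K[X]) :=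
  Submodule.span K {1, xOp K, derOp K, intOp K} ^ n

variable {K}

lemma derOp_mul_xOp_sub : derOp K * xOp K - xOp K * derOp K = 1 := by
  refine LinearMap.ext fun p => ?_
  change derivative (X * p) - X * derivative p = p
  rw [derivative_mul, derivative_X]
  ring

lemma mul_mem_wordFiltration {m n : ℕ} {S T : Module.End K K[X]} (hS : S ∈ wordFiltration K m)
    (hT : T ∈ wordFiltration K n) : S * T ∈ wordFiltration K (m + n) := by
  rw [wordFiltration, pow_add]
  exact Submodule.mul_mem_mul hS hT

lemma wordFiltration_mono : Monotone (wordFiltration K) := by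
  refine monotone_nat_of_le_succ fun n b hb => ?_
  rw [wordFiltration, pow_succ, ← mul_one b]
  exact Submodule.mul_mem_mul hb (Submodule.subset_span (by simp))

instance finiteDimensional_wordFiltration (n : ℕ) :
    FiniteDimensional K (wordFiltration K n) :=
  Module.Finite.iff_fg.mpr ((Submodule.fg_span (by simp)).pow n)

lemma mem_wordFiltration_one {g : Module.End K K[X]}
    (hg : g ∈ ({1, xOp K, derOp K, intOp K} : Set (Module.End K K[X]))) :
    g ∈ wordFiltration K 1 := by
  rw [wordFiltration, pow_one]
  exact Submodule.subset_span hg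

lemma xOp_mul_mem_wordFiltration {n : ℕ} {T : Module.End K K[X]}
    (hT : T ∈ wordFiltration K n) : xOp K * T ∈ wordFiltration K (n + 1) :=
  add_comm 1 n ▸ mul_mem_wordFiltration (mem_wordFiltration_one (by simp)) hT

lemma derOp_mul_mem_wordFiltration {n : ℕ} {T : Module.End K K[X]}
    (hT : T ∈ wordFiltration K n) : derOp K * T ∈ wordFiltration K (n + 1) :=
  add_comm 1 n ▸ mul_mem_wordFiltration (mem_wordFiltration_one (by simp)) hT

lemma exists_mem_wordFiltration {T : Module.End K K[X]} (hT : T ∈ I1 K) :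
    ∃ n, T ∈ wordFiltration K n := by
  induction hT using Algebra.adjoin_induction with
  | mem g hg => exact ⟨1, mem_wordFiltration_one (Or.inr hg)⟩
  | algebraMap r =>
    refine ⟨0, ?_⟩
    rw [wordFiltration, pow_zero]
    exact Submodule.algebraMap_mem r
  | add x y hx hy ihx ihy =>
    obtain ⟨m, hm⟩ := ihx
    obtain ⟨n, hn⟩ := ihy
    exact ⟨max m n, Submodule.add_mem _ (wordFiltration_mono (le_max_left m n) hm)
      (wordFiltration_mono (le_max_right m n) hn)⟩
  | mul x y hx hy ihx ihy =>
    obtain ⟨m, hm⟩ := ihx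
    obtain ⟨n, hn⟩ := ihy
    exact ⟨m + n, mul_mem_wordFiltration hm hn⟩

lemma wordFiltration_le_bandOp (n : ℕ) : wordFiltration K n ≤ bandOp K n := by
  induction n with
  | zero =>
    intro T hT
    rw [wordFiltration, pow_zero, Submodule.mem_one] at hT
    obtain ⟨r, rfl⟩ := hT
    rw [Algebra.algebraMap_eq_smul_one]
    exact Submodule.smul_mem _ r one_mem_bandOp
  | succ n ih =>
    rw [wordFiltration, pow_succ', Submodule.mul_le]
    intro g hg T hT
    have hband := ih hT
    induction hg using Submodule.span_induction with
    | mem g hg =>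
      rcases hg with rfl | rfl | rfl | rfl
      · rw [one_mul]; exact bandOp_le_succ n hband
      · exact xOp_mul_mem_bandOp hband
      · exact derOp_mul_mem_bandOp hband
      · exact intOp_mul_mem_bandOp hband
    | zero => rw [zero_mul]; exact Submodule.zero_mem _
    | add g g' _ _ h h' => rw [add_mul]; exact Submodule.add_mem _ h h'
    | smul r g _ h => rw [smul_mul_assoc]; exact Submodule.smul_mem _ r h

/-- A subspace of `bandOp K n` on which the columns `0, …, N - 1` are jointly injective
has dimension at most `N (n + N + 1)`. -/
lemma finrank_le_of_columns {n N : ℕ} (S : Submodule K (Module.End K K[X]))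
    (hS : S ≤ bandOp K n) (hinj : ∀ T ∈ S, (∀ i < N, T (X ^ i) = 0) → T = 0) :
    finrank K S ≤ N * (n + N + 1) := by
  let f : S →ₗ[K] (Fin N → degreeLT K (n + N + 1)) := LinearMap.pi fun i =>
    LinearMap.codRestrict _ (LinearMap.applyₗ (X ^ (i : ℕ) : K[X]) ∘ₗ S.subtype) fun T => by
      have hi := i.2
      refine mem_degreeLT.mpr (degree_le_natDegree.trans_lt (Nat.cast_lt.mpr ?_))
      exact (natDegree_apply_X_pow_le (hS T.2) i).trans_lt (by omega)
  have hf : Function.Injective f := by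
    rw [injective_iff_map_eq_zero]
    intro T hT
    refine Subtype.ext (hinj T T.2 fun i hi => ?_)
    exact congrArg Subtype.val (congrFun hT ⟨i, hi⟩)
  have hfin : FiniteDimensional K (degreeLT K (n + N + 1)) :=
    (degreeLTEquiv K (n + N + 1)).symm.finiteDimensional
  have hrank := LinearMap.finrank_le_finrank_of_injective hf
  rw [Module.finrank_pi_fintype, (degreeLTEquiv K (n + N + 1)).finrank_eq] at hrank
  simpa using hrank

lemma finrank_wordFiltration_le (n : ℕ) :
    finrank K (wordFiltration K n) ≤ (2 * n + 1) * (3 * n + 2) := by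
  have h := finrank_le_of_columns (n := n) (N := 2 * n + 1) (wordFiltration K n)
    (wordFiltration_le_bandOp n)
    fun b hb h0 => eq_zero_of_mem_bandOp (wordFiltration_le_bandOp n hb) h0
  rwa [show n + (2 * n + 1) + 1 = 3 * n + 2 by ring] at h

end Filtration

section Modules

open Module

variable {K} {A : Type*} [Ring A] [Algebra K A] {φ : A →ₐ[K] Module.End K K[X]}

/-- A left ideal whose elements are determined by finitely many columns has finite length. -/
lemma isFiniteLength_of_columns (hφ : Function.Injective φ) (hrange : φ.range = I1 K)
    (L : Submodule A A) (N : ℕ) (hL : ∀ b ∈ L, (∀ i < N, φ b (X ^ i) = 0) → b = 0) :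
    IsFiniteLength A L := by
  obtain ⟨x, hx⟩ : xOp K ∈ φ.range := hrange ▸ xOp_mem K
  obtain ⟨d, hd⟩ : derOp K ∈ φ.range := hrange ▸ derOp_mem K
  change φ x = _ at hx
  change φ d = _ at hd
  have hdx : d * x - x * d = 1 := hφ (by
    rw [map_sub, map_mul, map_mul, hx, hd, map_one, derOp_mul_xOp_sub])
  let ι : L →ₗ[K] Module.End K K[X] := φ.toLinearMap ∘ₗ L.subtype.restrictScalars K
  have hι : Function.Injective ι := hφ.comp Subtype.val_injective
  let Γ : ℕ → Submodule K L := fun n => (wordFiltration K n).comap ι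
  have hι' (n : ℕ) : Function.Injective (ι.domRestrict (Γ n)) :=
    hι.comp Subtype.val_injective
  have hfin (n : ℕ) : FiniteDimensional K (Γ n) :=
    finiteDimensional_comap hι (wordFiltration K n)
  refine isFiniteLength_of_linear_growth hdx Γ
    (fun m n h => Submodule.comap_mono (wordFiltration_mono h))
    (fun n v hv => ?_) (fun n v hv => ?_)
    (fun v => exists_mem_wordFiltration (hrange ▸ ⟨(v : A), rfl⟩)) (N * (N + 1)) fun n => ?_
  · change φ (d * v) ∈ wordFiltration K (n + 1)
    rw [map_mul, hd]
    exact derOp_mul_mem_wordFiltration hv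
  · change φ (x * v) ∈ wordFiltration K (n + 1)
    rw [map_mul, hx]
    exact xOp_mul_mem_wordFiltration hv
  · rw [← LinearMap.finrank_range_of_inj (hι' n), LinearMap.range_domRestrict]
    refine (finrank_le_of_columns (n := n) (N := N) _ ((Submodule.map_comap_le _ _).trans
      (wordFiltration_le_bandOp n)) ?_).trans ?_
    · rintro _ ⟨b, _, rfl⟩ h0
      have hb : b = 0 := Subtype.ext (hL b b.2 h0)
      rw [hb, map_zero]
    · rw [mul_assoc]
      exact Nat.mul_le_mul_left N (by nlinarith)

/-- If right multiplication by `a` has a kernel determined by finitely many columns, then its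
cokernel has finite length. -/
lemma isFiniteLength_coker_of_columns (hφ : Function.Injective φ) (hrange : φ.range = I1 K)
    (a : A) (N : ℕ) (hN : ∀ b, b * a = 0 → (∀ i < N, φ b (X ^ i) = 0) → b = 0) :
    IsFiniteLength A (Coker A (rmulMap A a)) := by
  obtain ⟨x, hx⟩ : xOp K ∈ φ.range := hrange ▸ xOp_mem K
  obtain ⟨d, hd⟩ : derOp K ∈ φ.range := hrange ▸ derOp_mem K
  change φ x = _ at hx
  change φ d = _ at hd
  have hdx : d * x - x * d = 1 := hφ (by
    rw [map_sub, map_mul, map_mul, hx, hd, map_one, derOp_mul_xOp_sub])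
  have hmem (b : A) : ∃ n, φ b ∈ wordFiltration K n :=
    exists_mem_wordFiltration (hrange ▸ ⟨b, rfl⟩)
  obtain ⟨m, ham, hm⟩ : ∃ m, φ a ∈ wordFiltration K m ∧ 1 ≤ m := by
    obtain ⟨m, hm⟩ := hmem a
    exact ⟨m + 1, wordFiltration_mono (Nat.le_succ m) hm, Nat.le_add_left 1 m⟩
  let V : ℕ → Submodule K A := fun n => (wordFiltration K n).comap φ.toLinearMap
  have hVmono : Monotone V := fun m n h => Submodule.comap_mono (wordFiltration_mono h)
  have hVfin (n : ℕ) : FiniteDimensional K (V n) :=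
    finiteDimensional_comap (f := φ.toLinearMap) hφ (wordFiltration K n)
  have hfinrank (S : Submodule K A) : finrank K S = finrank K (S.map φ.toLinearMap) := by
    rw [← LinearMap.range_domRestrict, LinearMap.finrank_range_of_inj]
    exact hφ.comp Subtype.val_injective
  have hVrank (n : ℕ) : finrank K (V n) ≤ (2 * n + 1) * (3 * n + 2) := by
    rw [hfinrank]
    exact (Submodule.finrank_mono (Submodule.map_comap_le _ _)).trans (finrank_wordFiltration_le n)
  let ρ : A →ₗ[K] A := LinearMap.mulRight K a
  let π : A →ₗ[K] Coker A (rmulMap A a) := (LinearMap.range (rmulMap A a)).mkQ.restrictScalars K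
  have hπ (b : A) : π (b * a) = 0 := (Submodule.Quotient.mk_eq_zero _).mpr ⟨b, rfl⟩
  have hker (n : ℕ) : finrank K (V n ⊓ LinearMap.ker ρ : Submodule K A) ≤ N * (n + N + 1) := by
    rw [hfinrank]
    refine finrank_le_of_columns _ ?_ ?_
    · rintro _ ⟨b, ⟨hb, _⟩, rfl⟩
      exact wordFiltration_le_bandOp n hb
    · rintro _ ⟨b, ⟨_, hb⟩, rfl⟩ h0
      rw [hN b hb h0, map_zero]
  have hrec (n : ℕ) : finrank K ((V (n + m)).map π) + finrank K (V n)
      ≤ finrank K (V (n + m)) + N * (n + N + 1) := by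
    have h1 := finrank_map_add_finrank_inf_ker π (V (n + m))
    have h2 := finrank_map_add_finrank_inf_ker ρ (V n)
    have h3 : (V n).map ρ ≤ V (n + m) ⊓ LinearMap.ker π := by
      rintro _ ⟨b, hb, rfl⟩
      refine ⟨?_, hπ b⟩
      change φ (b * a) ∈ wordFiltration K (n + m)
      rw [map_mul]
      exact mul_mem_wordFiltration hb ham
    have h4 := Submodule.finrank_mono h3
    have h5 := hker n
    omega
  have hΓmono : Monotone fun n => (V n).map π := fun i j h => Submodule.map_mono (hVmono h)
  have hsum (s r : ℕ) : r * finrank K ((V s).map π) + finrank K (V (m * s))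
      ≤ finrank K (V (m * (s + r))) + r * (N * (m * (s + r) + N + 1)) := by
    induction r with
    | zero => simp
    | succ r ih =>
      have h1 := hrec (m * (s + r))
      have h2 : finrank K ((V s).map π) ≤ finrank K ((V (m * (s + r) + m)).map π) :=
        Submodule.finrank_mono (hΓmono (by nlinarith))
      rw [show m * (s + r) + m = m * (s + (r + 1)) by ring] at h1 h2
      have h3 : N * (m * (s + r) + N + 1) ≤ N * (m * (s + (r + 1)) + N + 1) :=
        Nat.mul_le_mul_left _ (by nlinarith)
      have h4 := Nat.mul_le_mul_left r h3
      nlinarith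
  have hlin (s : ℕ) : finrank K ((V (s + 1)).map π)
      ≤ ((4 * m + 1) * (6 * m + 2) + N * (2 * m + N + 1)) * (s + 1) := by
    have h1 := hsum (s + 1) (s + 1)
    have h2 := hVrank (m * (s + 1 + (s + 1)))
    have h3 : (2 * (m * (s + 1 + (s + 1))) + 1) * (3 * (m * (s + 1 + (s + 1))) + 2)
        ≤ ((4 * m + 1) * (s + 1)) * ((6 * m + 2) * (s + 1)) :=
      Nat.mul_le_mul (by nlinarith) (by nlinarith)
    have h4 : N * (m * (s + 1 + (s + 1)) + N + 1) ≤ N * ((2 * m + N + 1) * (s + 1)) :=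
      Nat.mul_le_mul_left _ (by nlinarith)
    have h5 := Nat.mul_le_mul_left (s + 1) h4
    refine Nat.le_of_mul_le_mul_left (c := s + 1) ?_ (Nat.succ_pos s)
    calc (s + 1) * finrank K ((V (s + 1)).map π)
        ≤ ((4 * m + 1) * (s + 1)) * ((6 * m + 2) * (s + 1))
          + (s + 1) * (N * ((2 * m + N + 1) * (s + 1))) := by omega
      _ = _ := by ring
  refine isFiniteLength_of_linear_growth hdx (fun n => (V n).map π) hΓmono ?_ ?_ ?_
    ((4 * m + 1) * (6 * m + 2) + N * (2 * m + N + 1)) fun n =>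
      (Submodule.finrank_mono (hΓmono (Nat.le_succ n))).trans (hlin n)
  · rintro n _ ⟨v, hv, rfl⟩
    refine ⟨d * v, ?_, rfl⟩
    change φ (d * v) ∈ wordFiltration K (n + 1)
    rw [map_mul, hd]
    exact derOp_mul_mem_wordFiltration hv
  · rintro n _ ⟨v, hv, rfl⟩
    refine ⟨x * v, ?_, rfl⟩
    change φ (x * v) ∈ wordFiltration K (n + 1)
    rw [map_mul, hx]
    exact xOp_mul_mem_wordFiltration hv
  · intro v
    obtain ⟨b, rfl⟩ := Submodule.mkQ_surjective _ v
    obtain ⟨n, hn⟩ := hmem b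
    exact ⟨n, b, hn, rfl⟩

/-- `I₁` does not have finite length as a left module over itself. -/
lemma not_isFiniteLength_self (hφ : Function.Injective φ) (hrange : φ.range = I1 K) :
    ¬ IsFiniteLength A A := by
  intro hlen
  have := (isFiniteLength_iff_isNoetherian_isArtinian.mp hlen).2
  obtain ⟨d, hd⟩ : derOp K ∈ φ.range := hrange ▸ derOp_mem K
  obtain ⟨s, hs⟩ : intOp K ∈ φ.range := hrange ▸ intOp_mem K
  change φ d = _ at hd
  change φ s = _ at hs
  have hds : d * s = 1 := hφ (by
    rw [map_mul, hd, hs, map_one]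
    refine LinearMap.ext fun p => Polynomial.ext fun i => ?_
    have hi : (i : K) + 1 ≠ 0 := by exact_mod_cast i.succ_ne_zero
    simp [derOp, coeff_derivative, coeff_intOp_succ, hi])
  have hinj : Function.Injective (rmulMap A d) := by
    intro b c hbc
    have h := congrArg (· * s) (show b * d = c * d from hbc)
    simpa [mul_assoc, hds] using h
  obtain ⟨b, hb⟩ := IsArtinian.surjective_of_injective_endomorphism _ hinj 1
  have h1 := congrArg φ (show b * d = 1 from hb)
  rw [map_mul, hd, map_one] at h1
  have h2 := LinearMap.congr_fun h1 (1 : K[X])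
  simp [derOp] at h2

/-- The source of a linear map with kernel and range of finite length is a module of finite
length. -/
lemma isFiniteLength_of_ker_range {R M N : Type*} [Ring R] [AddCommGroup M] [Module R M]
    [AddCommGroup N] [Module R N] (f : M →ₗ[R] N) (hk : IsFiniteLength R (LinearMap.ker f))
    (hr : IsFiniteLength R (LinearMap.range f)) : IsFiniteLength R M := by
  rw [isFiniteLength_iff_isNoetherian_isArtinian] at *
  obtain ⟨_, _⟩ := hk
  obtain ⟨_, _⟩ := hr
  have h : LinearMap.range (LinearMap.ker f).subtype = LinearMap.ker f.rangeRestrict := by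
    rw [Submodule.range_subtype, LinearMap.ker_rangeRestrict]
  exact ⟨isNoetherian_of_range_eq_ker _ _ h, isArtinian_of_range_eq_ker _ _ h⟩

/-- The finite-length criterion for right multiplication, in a ring `A` identified with `I₁` by
an injective algebra map `φ`. -/
theorem finiteLength_rmulMap_iff (hφ : Function.Injective φ) (hrange : φ.range = I1 K) (a : A) :
    ((IsFiniteLength A (LinearMap.ker (rmulMap A a)) ↔
        IsFiniteLength A (Coker A (rmulMap A a)))
      ∧ (IsFiniteLength A (LinearMap.ker (rmulMap A a)) ↔ φ a ∉ Fset K))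
    ∧ (IsFiniteLength A (LinearMap.range (rmulMap A a)) ↔ φ a ∈ Fset K) := by
  have hself := not_isFiniteLength_self hφ hrange
  by_cases ha : φ a ∈ Fset K
  · have hr : IsFiniteLength A (LinearMap.range (rmulMap A a)) := by
      obtain ⟨N, hN⟩ := mem_Fset_iff.mp ha
      refine isFiniteLength_of_columns hφ hrange _ N ?_
      rintro _ ⟨b, rfl⟩ h0
      change ∀ i < N, φ (b * a) (X ^ i) = 0 at h0
      change b * a = 0
      refine hφ (end_ext_X_pow fun j => ?_)
      rw [map_zero, LinearMap.zero_apply]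
      rcases lt_or_ge j N with hj | hj
      · exact h0 j hj
      · rw [map_mul, Module.End.mul_apply, hN j hj, map_zero]
    have hk : ¬ IsFiniteLength A (LinearMap.ker (rmulMap A a)) := fun hk =>
      hself (isFiniteLength_of_ker_range _ hk hr)
    have hc : ¬ IsFiniteLength A (Coker A (rmulMap A a)) := fun hc =>
      hself (isFiniteLength_of_ker_range (LinearMap.range (rmulMap A a)).mkQ
        (by rwa [Submodule.ker_mkQ])
        (hc.of_injective (Submodule.subtype_injective _)))
    simp only [hr, hk, hc, ha, not_true, iff_self, and_self]
  · obtain ⟨m, hm⟩ := exists_mem_wordFiltration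
      (show φ a ∈ I1 K from hrange ▸ (⟨a, rfl⟩ : φ a ∈ φ.range))
    obtain ⟨N, hN⟩ := exists_bound_of_notMem_Fset (wordFiltration_le_bandOp m hm) ha
    have hN' (b : A) (hb : b * a = 0) (h0 : ∀ i < N, φ b (X ^ i) = 0) : b = 0 :=
      hφ (by rw [map_zero]; exact hN (φ b) (by rw [← map_mul, hb, map_zero]) h0)
    have hk := isFiniteLength_of_columns hφ hrange (LinearMap.ker (rmulMap A a)) N hN'
    have hc := isFiniteLength_coker_of_columns hφ hrange a N hN'
    have hr : ¬ IsFiniteLength A (LinearMap.range (rmulMap A a)) := fun hr =>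
      hself (isFiniteLength_of_ker_range _ hk hr)
    simp only [hr, hk, hc, ha, not_false_iff, iff_self, and_self]

end Modules

/-- for `a ∈ I₁` and `·a : I₁ → I₁, b ↦ ba`: the kernel has finite length
iff the cokernel `I₁/I₁a` has finite length, iff `a ∉ F`; and the image `I₁a` has finite
length iff `a ∈ F`. -/
theorem statement4 (a : I1 K) :
    ((IsFiniteLength (I1 K) ↥(LinearMap.ker (rmulMap (I1 K) a)) ↔
        IsFiniteLength (I1 K) (Coker (I1 K) (rmulMap (I1 K) a)))
      ∧ (IsFiniteLength (I1 K) ↥(LinearMap.ker (rmulMap (I1 K) a)) ↔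
          (a : Module.End K (Polynomial K)) ∉ Fset K))
    ∧ (IsFiniteLength (I1 K) ↥(LinearMap.range (rmulMap (I1 K) a)) ↔
        (a : Module.End K (Polynomial K)) ∈ Fset K) := by
  let r : Ring (I1 K) := inferInstance
  let alg : @Algebra K (I1 K) _ r.toSemiring := (I1 K).algebra
  let φ : @AlgHom K (I1 K) (Module.End K K[X]) _ r.toSemiring _ alg _ := (I1 K).val
  have hrange : φ.range = I1 K := Subalgebra.range_val _
  exact @finiteLength_rmulMap_iff K _ _ (I1 K) r alg φ Subtype.val_injective hrange a

end
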